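/- arXiv:2212.13182 — 8 statements merged into one kernel-verified Lean document; each statement's English description precedes it below -/
import Mathlib

section
/- Let A ∈ ℝ^{m×n}, b ∈ ℝ^m, v ∈ ℝ^n, with P = {x ∈ ℝ^n : Ax = b, x ≥ 0} nonempty, and define F(y) = A(v + Aᵀy)₊ − b for y ∈ ℝ^m. If F(y) = 0 for some y ∈ ℝ^m, then the point x = (v + Aᵀy)₊ is the unique minimizer of ‖x − v‖ over P, i.e., x is the orthogonal projection of v onto P. -/
open Matrix BigOperators

/-- The quadratic growth of `q ↦ (q - v)² - 2 * w * q` on the half-line `0 ≤ q` around its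
minimizer `max 0 (v + w)`. -/
theorem sq_sub_max_add_le {v w q : ℝ} (hq : 0 ≤ q) :
    (max 0 (v + w) - v) ^ 2 + 2 * (w * (q - max 0 (v + w))) + (q - max 0 (v + w)) ^ 2
      ≤ (q - v) ^ 2 := by
  rcases le_total 0 (v + w) with h | h
  · rw [max_eq_right h]
    exact le_of_eq (by ring)
  · rw [max_eq_left h]
    nlinarith [mul_nonneg hq (neg_nonneg.mpr h)]

/-- Vectors in the range of `Aᵀ` are orthogonal to differences of points in a fibre of `A`. -/
theorem sum_transpose_mulVec_mul_sub_eq_zero {m n : Type*} [Fintype m] [Fintype n]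
    (A : Matrix m n ℝ) (y : m → ℝ) {p x : n → ℝ} (h : A.mulVec p = A.mulVec x) :
    ∑ i, Aᵀ.mulVec y i * (p i - x i) = 0 := by
  change Aᵀ.mulVec y ⬝ᵥ (p - x) = 0
  rw [mulVec_transpose, ← dotProduct_mulVec, mulVec_sub, h, sub_self, dotProduct_zero]

/-- If F(y) = A(v + Aᵀy)₊ − b = 0, then x = (v + Aᵀy)₊ is the unique minimizer of
    ‖x − v‖ over P = {x : Ax = b, x ≥ 0}, i.e. the projection of v onto P. -/
theorem stmt1 {m n : ℕ} (A : Matrix (Fin m) (Fin n) ℝ) (b : Fin m → ℝ) (v : Fin n → ℝ)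
    (hP : ∃ x : Fin n → ℝ, A.mulVec x = b ∧ ∀ i, 0 ≤ x i)
    (y : Fin m → ℝ)
    (hF : A.mulVec (fun i => max 0 (v i + Aᵀ.mulVec y i)) = b) :
    ((A.mulVec (fun i => max 0 (v i + Aᵀ.mulVec y i)) = b) ∧
      (∀ i, 0 ≤ max 0 (v i + Aᵀ.mulVec y i))) ∧
    ∀ p : Fin n → ℝ, A.mulVec p = b → (∀ i, 0 ≤ p i) →
      p ≠ (fun i => max 0 (v i + Aᵀ.mulVec y i)) →
      ∑ i, (max 0 (v i + Aᵀ.mulVec y i) - v i)^2 < ∑ i, (p i - v i)^2 := by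
  refine ⟨⟨hF, fun i => le_max_left _ _⟩, fun p hp hp0 hne => ?_⟩
  have horth := sum_transpose_mulVec_mul_sub_eq_zero A y (hp.trans hF.symm)
  have hpos : 0 < ∑ i, (p i - max 0 (v i + Aᵀ.mulVec y i)) ^ 2 := by
    obtain ⟨j, hj⟩ := Function.ne_iff.mp hne
    exact Finset.sum_pos' (fun i _ => sq_nonneg _)
      ⟨j, Finset.mem_univ j, sq_pos_of_ne_zero (sub_ne_zero.mpr hj)⟩
  have hle := Finset.sum_le_sum fun i (_ : i ∈ Finset.univ) =>
    sq_sub_max_add_le (v := v i) (w := Aᵀ.mulVec y i) (hp0 i)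
  rw [Finset.sum_add_distrib, Finset.sum_add_distrib, ← Finset.mul_sum, horth] at hle
  linarith
end

section
/- Let A ∈ ℝ^{m×n}, b ∈ ℝ^m, v ∈ ℝ^n, with P = {x ∈ ℝ^n : Ax = b, x ≥ 0} nonempty. Then there exists y ∈ ℝ^m such that A(v + Aᵀy)₊ = b, i.e., the nonsmooth equation F(y) = 0 has a solution. -/
open Matrix BigOperators

/-- Farkas' lemma for finitely many linear functionals on a real vector space. -/
theorem farkas_linear_functionals {ι E : Type*} [AddCommGroup E] [Module ℝ E]
    (s : Finset ι) (f : ι → E →ₗ[ℝ] ℝ) (g : E →ₗ[ℝ] ℝ)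
    (h : ∀ z, (∀ i ∈ s, 0 ≤ f i z) → 0 ≤ g z) :
    ∃ c : ι → ℝ, (∀ i, 0 ≤ c i) ∧ ∀ z, g z = ∑ i ∈ s, c i * f i z := by
  classical
  induction s using Finset.induction_on generalizing f g with
  | empty =>
    refine ⟨fun _ => 0, fun _ => le_rfl, fun z => ?_⟩
    have h1 := h z (by simp)
    have h2 := h (-z) (by simp)
    rw [map_neg] at h2
    simp only [Finset.sum_empty]
    linarith
  | insert a s ha ih =>
    by_cases hg : ∀ z, (∀ i ∈ s, 0 ≤ f i z) → 0 ≤ g z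
    · obtain ⟨c, hc, hgc⟩ := ih f g hg
      refine ⟨fun i => if i = a then 0 else c i, fun i => ?_, fun z => ?_⟩
      · dsimp only
        split_ifs
        exacts [le_rfl, hc i]
      · rw [Finset.sum_insert ha, hgc z]
        simp only [if_true, zero_mul, zero_add]
        refine Finset.sum_congr rfl fun i hi => ?_
        rw [if_neg (ne_of_mem_of_not_mem hi ha)]
    · push Not at hg
      obtain ⟨x, hx, hgx⟩ := hg
      have hax : f a x < 0 := by
        by_contra! hax
        exact absurd (h x (by simpa [hax] using hx)) (not_le.mpr hgx)
      set r : ℝ := -(f a x)⁻¹ with hr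
      have hr0 : 0 < r := by
        rw [hr, neg_pos]
        exact inv_lt_zero.mpr hax
      have hrx : r * f a x = -1 := by
        rw [hr, neg_mul, inv_mul_cancel₀ hax.ne]
      obtain ⟨c, hc, hgc⟩ := ih (fun i => f i + (r * f i x) • f a) (g + (r * g x) • f a) (by
        intro z hz
        have key := h (z + (r * f a z) • x) (by
          intro i hi
          rw [map_add, map_smul, smul_eq_mul]
          rcases Finset.mem_insert.mp hi with rfl | hi
          · exact le_of_eq (by linear_combination (-(f i z)) * hrx)
          · have := hz i hi
            simp only [LinearMap.add_apply, LinearMap.smul_apply, smul_eq_mul] at this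
            linarith)
        simp only [map_add, map_smul, LinearMap.add_apply, LinearMap.smul_apply,
          smul_eq_mul] at key ⊢
        linarith)
      refine ⟨fun i => if i = a then ∑ j ∈ s, c j * (r * f j x) - r * g x else c i,
        fun i => ?_, fun z => ?_⟩
      · dsimp only
        split_ifs
        · have h1 : 0 ≤ ∑ j ∈ s, c j * (r * f j x) :=
            Finset.sum_nonneg fun j hj => mul_nonneg (hc j) (mul_nonneg hr0.le (hx j hj))
          nlinarith
        · exact hc i
      · have hz := hgc z
        simp only [LinearMap.add_apply, LinearMap.smul_apply, smul_eq_mul, mul_add,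
          Finset.sum_add_distrib] at hz
        rw [Finset.sum_insert ha]
        dsimp only
        rw [if_pos rfl, sub_mul, Finset.sum_mul]
        have e : ∑ i ∈ s, (if i = a then ∑ j ∈ s, c j * (r * f j x) - r * g x else c i) * f i z
            = ∑ i ∈ s, c i * f i z := by
          refine Finset.sum_congr rfl fun i hi => ?_
          rw [if_neg (ne_of_mem_of_not_mem hi ha)]
        rw [e]
        simp only [mul_assoc] at hz ⊢
        linarith

/-- The polyhedron `{x : Ax = b, x ≥ 0}`, if nonempty, contains a nearest point to `v`, described
by its variational inequality. -/
theorem exists_projection_polyhedron {m n : ℕ} (A : Matrix (Fin m) (Fin n) ℝ) (b : Fin m → ℝ)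
    (v : Fin n → ℝ) (hP : ∃ x : Fin n → ℝ, A.mulVec x = b ∧ ∀ i, 0 ≤ x i) :
    ∃ x : Fin n → ℝ, A.mulVec x = b ∧ (∀ i, 0 ≤ x i) ∧
      ∀ w : Fin n → ℝ, A.mulVec w = b → (∀ i, 0 ≤ w i) → 0 ≤ (x - v) ⬝ᵥ (w - x) := by
  let K : Set (EuclideanSpace ℝ (Fin n)) := {x | A.mulVec x.ofLp = b ∧ ∀ i, 0 ≤ x i}
  have hne : K.Nonempty := by
    obtain ⟨x, hx⟩ := hP
    exact ⟨WithLp.toLp 2 x, hx⟩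
  have hclosed : IsClosed K := by
    refine IsClosed.inter (isClosed_eq ?_ continuous_const) ?_
    · exact Continuous.matrix_mulVec continuous_const (PiLp.continuous_ofLp 2 _)
    · change IsClosed {x : EuclideanSpace ℝ (Fin n) | ∀ i, 0 ≤ x i}
      rw [Set.ofPred_forall]
      exact isClosed_iInter fun i => isClosed_le continuous_const (by fun_prop)
  have hconv : Convex ℝ K := by
    rintro x ⟨hx, hx0⟩ y ⟨hy, hy0⟩ s t hs ht hst
    refine ⟨?_, fun i => ?_⟩
    · rw [WithLp.ofLp_add, WithLp.ofLp_smul, WithLp.ofLp_smul, mulVec_add, mulVec_smul,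
        mulVec_smul, hx, hy, ← add_smul, hst, one_smul]
    · exact add_nonneg (mul_nonneg hs (hx0 i)) (mul_nonneg ht (hy0 i))
  obtain ⟨x, hxK, hx⟩ :=
    exists_norm_eq_iInf_of_complete_convex hne hclosed.isComplete hconv (WithLp.toLp 2 v)
  rw [norm_eq_iInf_iff_real_inner_le_zero hconv hxK] at hx
  refine ⟨x.ofLp, hxK.1, hxK.2, fun w hw hw0 => ?_⟩
  have h := hx (WithLp.toLp 2 w) ⟨hw, hw0⟩
  rw [EuclideanSpace.inner_eq_star_dotProduct] at h
  simp only [WithLp.ofLp_sub, star_trivial] at h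
  rw [dotProduct_comm, ← neg_sub v, dotProduct_neg]
  linarith

/-- If P = {x : Ax = b, x ≥ 0} is nonempty, then the nonsmooth equation
    F(y) = A(v + Aᵀy)₊ − b = 0 has a solution y ∈ ℝ^m. -/
theorem stmt2 {m n : ℕ} (A : Matrix (Fin m) (Fin n) ℝ) (b : Fin m → ℝ) (v : Fin n → ℝ)
    (hP : ∃ x : Fin n → ℝ, A.mulVec x = b ∧ ∀ i, 0 ≤ x i) :
    ∃ y : Fin m → ℝ, A.mulVec (fun i => max 0 (v i + Aᵀ.mulVec y i)) = b := by
  obtain ⟨x, hx, hx0, hvar⟩ := exists_projection_polyhedron A b v hP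
  let row : Fin m → (Fin n → ℝ) →ₗ[ℝ] ℝ := fun j => LinearMap.proj j ∘ₗ A.mulVecLin
  let f : (Fin m ⊕ Fin m) ⊕ Fin n → (Fin n → ℝ) →ₗ[ℝ] ℝ :=
    Sum.elim (Sum.elim row (-row)) fun i => if x i = 0 then LinearMap.proj i else 0
  obtain ⟨c, hc, hgc⟩ := farkas_linear_functionals Finset.univ f (dotProductBilin ℝ ℝ (x - v)) (by
    intro d hd
    have hAd : A.mulVec d = 0 := by
      funext j
      have h1 := hd (Sum.inl (Sum.inl j)) (Finset.mem_univ _)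
      have h2 := hd (Sum.inl (Sum.inr j)) (Finset.mem_univ _)
      simp [f, row] at h1 h2
      exact le_antisymm h2 h1
    have hev : ∀ᶠ t : ℝ in nhdsWithin 0 (Set.Ioi 0), ∀ i, 0 ≤ x i + t * d i := by
      rw [Filter.eventually_all]
      intro i
      by_cases hi : x i = 0
      · have h3 := hd (Sum.inr i) (Finset.mem_univ _)
        simp [f, hi] at h3
        filter_upwards [self_mem_nhdsWithin] with t ht
        rw [hi, zero_add]
        exact mul_nonneg (le_of_lt ht) h3
      · have hpos : 0 < x i := lt_of_le_of_ne (hx0 i) (Ne.symm hi)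
        have hcont : Continuous fun t : ℝ => x i + t * d i := by fun_prop
        have hlt : ∀ᶠ t : ℝ in nhds 0, 0 < x i + t * d i :=
          hcont.continuousAt.eventually_const_lt (by simpa using hpos)
        exact (hlt.filter_mono nhdsWithin_le_nhds).mono fun t ht => ht.le
    obtain ⟨t, ht, ht0⟩ := (hev.and self_mem_nhdsWithin).exists
    have h4 := hvar (x + t • d) (by rw [mulVec_add, mulVec_smul, hAd, smul_zero, add_zero, hx]) ht
    rw [add_sub_cancel_left, dotProduct_smul, smul_eq_mul] at h4
    exact nonneg_of_mul_nonneg_right h4 ht0)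
  refine ⟨fun j => c (Sum.inl (Sum.inl j)) - c (Sum.inl (Sum.inr j)), ?_⟩
  convert hx using 2
  funext i
  have h := hgc (Pi.single i 1)
  have hT : Aᵀ.mulVec (fun j => c (Sum.inl (Sum.inl j)) - c (Sum.inl (Sum.inr j))) i
      = x i - v i - if x i = 0 then c (Sum.inr i) else 0 := by
    have hs : (∑ j, Aᵀ i j * c (Sum.inl (Sum.inl j))) - ∑ j, Aᵀ i j * c (Sum.inl (Sum.inr j))
        = Aᵀ.mulVec (fun j => c (Sum.inl (Sum.inl j)) - c (Sum.inl (Sum.inr j))) i := by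
      simp only [mulVec, dotProduct, mul_sub, Finset.sum_sub_distrib]
    have hlast : ∑ k, c (Sum.inr k) * f (Sum.inr k) (Pi.single i 1)
        = if x i = 0 then c (Sum.inr i) else 0 := by
      rw [Finset.sum_eq_single i]
      · by_cases hi : x i = 0 <;> simp [f, hi]
      · intro k _ hk
        by_cases hk0 : x k = 0 <;> simp [f, hk0, hk]
      · simp
    rw [Fintype.sum_sum_type, Fintype.sum_sum_type, hlast] at h
    simp [f, row, dotProductBilin] at h
    simp only [transpose_apply] at hs
    rw [← hs]
    simp only [mul_comm (A _ i)]
    linarith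
  rw [hT]
  split_ifs with hi
  · rw [hi]
    exact max_eq_left (by linarith [hc (Sum.inr i)])
  · rw [max_eq_right] <;> linarith [hx0 i]
end

section
/- Let A ∈ ℝ^{m×n}, b ∈ ℝ^m, v ∈ ℝ^n, with P = {x ∈ ℝ^n : Ax = b, x ≥ 0} nonempty, and define F(y) = A(v + Aᵀy)₊ − b and f(y) = (1/2)‖F(y)‖². Then for any y ∈ ℝ^m, F(y) = 0 if and only if y is a global minimizer of f over ℝ^m. -/
open Matrix BigOperators

/-- The dual objective `½‖(v + Aᵀy)₊‖² - ⟨b, y⟩`, whose gradient is `A(v + Aᵀy)₊ - b`. -/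
noncomputable def dualObjective {m n : ℕ} (A : Matrix (Fin m) (Fin n) ℝ) (b : Fin m → ℝ)
    (v : Fin n → ℝ) (y : Fin m → ℝ) : ℝ :=
  ∑ i, (1/2) * (max 0 (v i + Aᵀ.mulVec y i))^2 - b ⬝ᵥ y

lemma half_sq_posPart_add_le (s d : ℝ) :
    (1/2) * (max 0 (s + d))^2 ≤ (1/2) * (max 0 s)^2 + max 0 s * d + (1/2) * d^2 := by
  rcases max_cases 0 s with ⟨h, h'⟩ | ⟨h, h'⟩ <;>
    rcases max_cases 0 (s + d) with ⟨k, k'⟩ | ⟨k, k'⟩ <;> rw [h, k] <;>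
    nlinarith [sq_nonneg (s + d), sq_nonneg d]

lemma mulVec_dotProduct_eq_dotProduct_transpose_mulVec {m n : ℕ} (A : Matrix (Fin m) (Fin n) ℝ)
    (p : Fin n → ℝ) (d : Fin m → ℝ) : A.mulVec p ⬝ᵥ d = p ⬝ᵥ Aᵀ.mulVec d := by
  rw [dotProduct_comm, dotProduct_mulVec, mulVec_transpose, dotProduct_comm]

lemma dualObjective_add_le {m n : ℕ} (A : Matrix (Fin m) (Fin n) ℝ) (b : Fin m → ℝ)
    (v : Fin n → ℝ) (u d : Fin m → ℝ) :
    dualObjective A b v (u + d) ≤ dualObjective A b v u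
      + (A.mulVec (fun i => max 0 (v i + Aᵀ.mulVec u i)) - b) ⬝ᵥ d
      + (1/2) * ∑ i, (Aᵀ.mulVec d i)^2 := by
  have key : ∑ i, (1/2) * (max 0 (v i + Aᵀ.mulVec (u + d) i))^2 ≤
      ∑ i, ((1/2) * (max 0 (v i + Aᵀ.mulVec u i))^2
        + max 0 (v i + Aᵀ.mulVec u i) * Aᵀ.mulVec d i + (1/2) * (Aᵀ.mulVec d i)^2) := by
    refine Finset.sum_le_sum fun i _ => ?_
    rw [mulVec_add, Pi.add_apply, ← add_assoc]
    exact half_sq_posPart_add_le _ _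
  rw [Finset.sum_add_distrib, Finset.sum_add_distrib, ← Finset.mul_sum _ _ (1/2 : ℝ),
    ← Finset.mul_sum _ _ (1/2 : ℝ), ← Finset.mul_sum _ _ (1/2 : ℝ)] at key
  rw [sub_dotProduct, mulVec_dotProduct_eq_dotProduct_transpose_mulVec]
  simp only [dualObjective, dotProduct_add, ← Finset.mul_sum]
  have h : (fun i => max 0 (v i + Aᵀ.mulVec u i)) ⬝ᵥ Aᵀ.mulVec d
      = ∑ i, max 0 (v i + Aᵀ.mulVec u i) * Aᵀ.mulVec d i := rfl
  linarith

lemma le_dualObjective {m n : ℕ} (A : Matrix (Fin m) (Fin n) ℝ) (v x : Fin n → ℝ)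
    (hx : ∀ i, 0 ≤ x i) (u : Fin m → ℝ) :
    ∑ i, (x i * v i - (1/2) * (x i)^2) ≤ dualObjective A (A.mulVec x) v u := by
  rw [dualObjective, mulVec_dotProduct_eq_dotProduct_transpose_mulVec, dotProduct,
    ← Finset.sum_sub_distrib]
  refine Finset.sum_le_sum fun i _ => ?_
  have h := mul_le_mul_of_nonneg_left (le_max_right 0 (v i + Aᵀ.mulVec u i)) (hx i)
  nlinarith [sq_nonneg (x i - max 0 (v i + Aᵀ.mulVec u i))]

lemma sum_sq_transpose_mulVec_le {m n : ℕ} (A : Matrix (Fin m) (Fin n) ℝ) (d : Fin m → ℝ) :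
    ∑ i, (Aᵀ.mulVec d i)^2 ≤ (∑ i, ∑ j, (A j i)^2) * ∑ j, (d j)^2 := by
  rw [Finset.sum_mul]
  exact Finset.sum_le_sum fun i _ => Finset.sum_mul_sq_le_sq_mul_sq Finset.univ (fun j => A j i) d

/-- One gradient step decreases the dual objective by a fixed multiple of the squared norm
of its gradient. -/
lemma exists_dualObjective_le_sub {m n : ℕ} (A : Matrix (Fin m) (Fin n) ℝ) (b : Fin m → ℝ)
    (v : Fin n → ℝ) : ∃ c > 0, ∀ u, ∃ w, dualObjective A b v w ≤ dualObjective A b v u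
      - c * ∑ j, (A.mulVec (fun i => max 0 (v i + Aᵀ.mulVec u i)) j - b j)^2 := by
  set K := ∑ i, ∑ j, (A j i)^2 with hK
  have hK0 : 0 ≤ K := by positivity
  set t := 1 / (K + 1) with ht
  have ht0 : 0 < t := by positivity
  have htK : t * K ≤ 1 := by
    have : t * (K + 1) = 1 := by rw [ht]; field_simp
    linarith
  refine ⟨t / 2, by positivity, fun u => ?_⟩
  set r := A.mulVec (fun i => max 0 (v i + Aᵀ.mulVec u i)) - b with hr
  refine ⟨u + (-t) • r, (dualObjective_add_le A b v u _).trans ?_⟩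
  have h1 := sum_sq_transpose_mulVec_le A ((-t) • r)
  have h2 : ∑ j, (((-t) • r) j)^2 = t^2 * ∑ j, (r j)^2 := by
    simp [Finset.mul_sum, mul_pow]
  have h3 : r ⬝ᵥ ((-t) • r) = -t * ∑ j, (r j)^2 := by
    rw [dotProduct_smul, smul_eq_mul, dotProduct]
    simp [sq]
  rw [h2, ← hK] at h1
  rw [← hr, h3]
  change _ ≤ _ - t / 2 * ∑ j, (r j)^2
  have hS : 0 ≤ t * ∑ j, (r j)^2 := by positivity
  nlinarith [mul_le_mul_of_nonneg_right htK hS]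

/-- F(y) = 0 iff y is a global minimizer of f(y) = (1/2)‖F(y)‖² over ℝ^m,
    where F(y) = A(v + Aᵀy)₊ − b and P = {x : Ax = b, x ≥ 0} is nonempty. -/
theorem stmt3 {m n : ℕ} (A : Matrix (Fin m) (Fin n) ℝ) (b : Fin m → ℝ) (v : Fin n → ℝ)
    (hP : ∃ x : Fin n → ℝ, A.mulVec x = b ∧ ∀ i, 0 ≤ x i)
    (y : Fin m → ℝ) :
    A.mulVec (fun i => max 0 (v i + Aᵀ.mulVec y i)) = b ↔
    ∀ u : Fin m → ℝ,
      (1/2) * ∑ j, (A.mulVec (fun i => max 0 (v i + Aᵀ.mulVec y i)) j - b j)^2 ≤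
      (1/2) * ∑ j, (A.mulVec (fun i => max 0 (v i + Aᵀ.mulVec u i)) j - b j)^2 := by
  constructor
  · intro h u
    rw [h]
    simp only [sub_self, ne_eq, OfNat.ofNat_ne_zero, not_false_eq_true, zero_pow,
      Finset.sum_const_zero, mul_zero]
    positivity
  · intro hmin
    obtain ⟨x, rfl, hx⟩ := hP
    obtain ⟨c, hc, hstep⟩ := exists_dualObjective_le_sub A (A.mulVec x) v
    set δ := ∑ j, (A.mulVec (fun i => max 0 (v i + Aᵀ.mulVec y i)) j - A.mulVec x j)^2 with hδ
    have hδ0 : 0 ≤ δ := by positivity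
    rcases hδ0.eq_or_lt with h0 | hpos
    · funext j
      have := (Finset.sum_eq_zero_iff_of_nonneg fun j _ => sq_nonneg _).1 (hδ ▸ h0.symm) j
        (Finset.mem_univ j)
      exact sub_eq_zero.1 (pow_eq_zero_iff two_ne_zero |>.1 this)
    · exfalso
      have hbdd : BddBelow (Set.range (dualObjective A (A.mulVec x) v)) :=
        ⟨_, Set.forall_mem_range.2 (le_dualObjective A v x hx)⟩
      obtain ⟨u, hu⟩ := exists_lt_of_ciInf_lt (lt_add_of_pos_right
        (⨅ u, dualObjective A (A.mulVec x) v u) (mul_pos hc hpos))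
      obtain ⟨w, hw⟩ := hstep u
      have hle := ciInf_le hbdd w
      have := mul_le_mul_of_nonneg_left (hmin u) hc.le
      linarith
end

section
/- Let A ∈ ℝ^{m×n}, b ∈ ℝ^m, and P = {x ∈ ℝ^n : Ax = b, x ≥ 0}, and let x ∈ P. Then the nonnegative polar cone of P at x satisfies (P − x)⁺ := {w ∈ ℝ^n : ⟨w, p − x⟩ ≥ 0 for all p ∈ P} = {w ∈ ℝ^n : w = Aᵀu + z for some u ∈ ℝ^m and z ∈ ℝ^n with z ≥ 0 and xᵀz = 0}. -/
open Matrix BigOperators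

/-- **Farkas lemma**: a vector whose inner product is nonnegative on the polyhedral cone cut out by
finitely many vectors is a nonnegative combination of these vectors. -/
theorem exists_nonneg_sum_smul_of_dotProduct_nonneg {𝕜 κ ι : Type*} [Field 𝕜] [LinearOrder 𝕜]
    [IsStrictOrderedRing 𝕜] [Fintype κ] (s : Finset ι) (a : ι → κ → 𝕜) (c : κ → 𝕜)
    (h : ∀ d : κ → 𝕜, (∀ i ∈ s, 0 ≤ a i ⬝ᵥ d) → 0 ≤ c ⬝ᵥ d) :
    ∃ l : ι → 𝕜, (∀ i, 0 ≤ l i) ∧ c = ∑ i ∈ s, l i • a i := by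
  classical
  induction s using Finset.induction_on generalizing a c with
  | empty =>
    refine ⟨0, fun _ => le_rfl, ?_⟩
    have h1 := h (-c) (by simp)
    rw [dotProduct_neg, Left.nonneg_neg_iff] at h1
    have h0 : 0 ≤ c ⬝ᵥ c := Finset.sum_nonneg fun i _ => mul_self_nonneg (c i)
    simpa using dotProduct_self_eq_zero.1 (le_antisymm h1 h0)
  | insert k s hk ih =>
    by_cases hs : ∀ d : κ → 𝕜, (∀ i ∈ s, 0 ≤ a i ⬝ᵥ d) → 0 ≤ c ⬝ᵥ d
    · obtain ⟨l, hl, hc⟩ := ih a c hs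
      refine ⟨Function.update l k 0, fun i => ?_, ?_⟩
      · rcases eq_or_ne i k with rfl | hi
        · simp
        · simpa [hi] using hl i
      · rw [Finset.sum_insert hk, hc]
        simp only [Function.update_self, zero_smul, zero_add]
        refine Finset.sum_congr rfl fun i hi => ?_
        rw [Function.update_of_ne (ne_of_mem_of_not_mem hi hk)]
    · push Not at hs
      obtain ⟨y, hy, hcy⟩ := hs
      have hky : a k ⬝ᵥ y < 0 := by
        by_contra! hky
        exact hcy.not_ge (h y (by simpa [hky] using hy))
      obtain ⟨e, he, hae, hce⟩ :
          ∃ e : κ → 𝕜, (∀ i ∈ s, 0 ≤ a i ⬝ᵥ e) ∧ a k ⬝ᵥ e = -1 ∧ c ⬝ᵥ e < 0 := by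
        have hr : 0 < (-(a k ⬝ᵥ y))⁻¹ := inv_pos.2 (neg_pos.2 hky)
        refine ⟨(-(a k ⬝ᵥ y))⁻¹ • y, fun i hi => ?_, ?_, ?_⟩
        · simpa only [dotProduct_smul, smul_eq_mul] using mul_nonneg hr.le (hy i hi)
        · rw [dotProduct_smul, smul_eq_mul]
          field_simp [hky.ne]
        · simpa only [dotProduct_smul, smul_eq_mul] using mul_neg_of_pos_of_neg hr hcy
      have key (v d : κ → 𝕜) :
          (v + (v ⬝ᵥ e) • a k) ⬝ᵥ d = v ⬝ᵥ (d + (a k ⬝ᵥ d) • e) := by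
        simp only [add_dotProduct, smul_dotProduct, dotProduct_add, dotProduct_smul, smul_eq_mul]
        ring
      obtain ⟨l, hl, hc⟩ := ih (fun i => a i + (a i ⬝ᵥ e) • a k) (c + (c ⬝ᵥ e) • a k) (by
        intro d hd
        rw [key]
        refine h _ fun i hi => ?_
        rcases Finset.mem_insert.1 hi with rfl | hi
        · simp [dotProduct_add, hae]
        · rw [← key]
          exact hd i hi)
      have hsum : 0 ≤ ∑ i ∈ s, l i * (a i ⬝ᵥ e) :=
        Finset.sum_nonneg fun i hi => mul_nonneg (hl i) (he i hi)
      refine ⟨Function.update l k (∑ i ∈ s, l i * (a i ⬝ᵥ e) - c ⬝ᵥ e), fun i => ?_, ?_⟩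
      · rcases eq_or_ne i k with rfl | hi
        · simp only [Function.update_self]
          linarith
        · simpa [hi] using hl i
      · have hcongr : ∑ i ∈ s, Function.update l k (∑ i ∈ s, l i * (a i ⬝ᵥ e) - c ⬝ᵥ e) i • a i =
            ∑ i ∈ s, l i • a i := Finset.sum_congr rfl fun i hi => by
          rw [Function.update_of_ne (ne_of_mem_of_not_mem hi hk)]
        rw [Finset.sum_insert hk, hcongr, Function.update_self, sub_smul, Finset.sum_smul]
        simp only [smul_add, Finset.sum_add_distrib, smul_smul] at hc
        exact (eq_sub_of_add_eq hc).trans (by abel)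

/-- A direction that is nonnegative on the vanishing coordinates of a nonnegative vector is feasible
for the nonnegative orthant at that vector. -/
theorem exists_pos_forall_nonneg_add_mul {ι : Type*} [Finite ι] {x d : ι → ℝ}
    (hx : ∀ i, 0 ≤ x i) (hd : ∀ i, x i = 0 → 0 ≤ d i) :
    ∃ t : ℝ, 0 < t ∧ ∀ i, 0 ≤ x i + t * d i := by
  have hev : ∀ᶠ t in nhdsWithin (0 : ℝ) (Set.Ioi 0), ∀ i, 0 ≤ x i + t * d i := by
    refine Filter.eventually_all.2 fun i => ?_
    rcases (hx i).eq_or_lt with hi | hi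
    · filter_upwards [self_mem_nhdsWithin] with t ht
      rw [← hi, zero_add]
      exact mul_nonneg (Set.mem_Ioi.1 ht).le (hd i hi.symm)
    · have hcont : Continuous fun t : ℝ => x i + t * d i := by fun_prop
      exact ((hcont.tendsto' 0 (x i) (by simp)).eventually (Ici_mem_nhds hi)).filter_mono
        nhdsWithin_le_nhds
  obtain ⟨t, ht, ht0⟩ := (hev.and self_mem_nhdsWithin).exists
  exact ⟨t, ht0, ht⟩

/-- The nonnegative polar cone of P = {x : Ax = b, x ≥ 0} at x ∈ P equals
    {w : w = Aᵀu + z, u ∈ ℝ^m, z ≥ 0, xᵀz = 0}. -/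
theorem stmt9 {m n : ℕ} (A : Matrix (Fin m) (Fin n) ℝ) (b : Fin m → ℝ)
    (x : Fin n → ℝ) (hxP : A.mulVec x = b ∧ ∀ i, 0 ≤ x i) :
    {w : Fin n → ℝ | ∀ p : Fin n → ℝ, A.mulVec p = b → (∀ i, 0 ≤ p i) →
        0 ≤ w ⬝ᵥ (p - x)} =
    {w : Fin n → ℝ | ∃ (u : Fin m → ℝ) (z : Fin n → ℝ),
        (∀ i, 0 ≤ z i) ∧ x ⬝ᵥ z = 0 ∧ w = Aᵀ.mulVec u + z} := by
  obtain ⟨hAx, hx⟩ := hxP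
  ext w
  simp only [Set.mem_ofPred_eq]
  constructor
  · intro hw
    obtain ⟨l, hl, hwl⟩ := exists_nonneg_sum_smul_of_dotProduct_nonneg Finset.univ
      (Sum.elim (Sum.elim A.row (-A.row)) fun i => if x i = 0 then Pi.single i (1 : ℝ) else 0) w (by
        intro d hd
        have hAd : A *ᵥ d = 0 := funext fun j => le_antisymm
          (show A.row j ⬝ᵥ d ≤ 0 by simpa using hd (.inl (.inr j)) (Finset.mem_univ _))
          (show 0 ≤ A.row j ⬝ᵥ d by simpa using hd (.inl (.inl j)) (Finset.mem_univ _))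
        obtain ⟨t, ht, hxt⟩ := exists_pos_forall_nonneg_add_mul hx fun i hi => by
          simpa [hi] using hd (.inr i) (Finset.mem_univ _)
        have := hw (x + t • d) (by rw [mulVec_add, mulVec_smul, hAd, smul_zero, add_zero, hAx])
          (by simpa using hxt)
        rw [add_sub_cancel_left, dotProduct_smul, smul_eq_mul] at this
        exact nonneg_of_mul_nonneg_right this ht)
    refine ⟨fun j => l (.inl (.inl j)) - l (.inl (.inr j)),
      fun i => if x i = 0 then l (.inr i) else 0, fun i => ?_, ?_, ?_⟩
    · dsimp only
      split_ifs
      exacts [hl _, le_rfl]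
    · refine Finset.sum_eq_zero fun i _ => ?_
      by_cases hi : x i = 0 <;> simp [hi]
    · rw [hwl]
      ext i
      simp only [Fintype.sum_sum_type, Sum.elim_inl, Sum.elim_inr, Pi.add_apply, Finset.sum_apply,
        Pi.smul_apply, smul_eq_mul, mulVec, dotProduct, transpose_apply]
      congr 1
      · rw [← Finset.sum_add_distrib]
        refine Finset.sum_congr rfl fun j _ => ?_
        rw [Pi.neg_apply, Pi.neg_apply, row_apply]
        ring
      · rw [Finset.sum_eq_single i]
        · by_cases hi : x i = 0 <;> simp [hi]
        · intro j _ hj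
          by_cases hxj : x j = 0 <;> simp [hxj, hj.symm]
        · simp
  · rintro ⟨u, z, hz, hxz, rfl⟩ p hAp hp
    have hu : Aᵀ *ᵥ u ⬝ᵥ (p - x) = 0 := by
      rw [mulVec_transpose, ← dotProduct_mulVec, mulVec_sub, hAp, hAx, sub_self, dotProduct_zero]
    rw [add_dotProduct, hu, zero_add, dotProduct_sub, dotProduct_comm z x, hxz, sub_zero]
    exact Finset.sum_nonneg fun i _ => mul_nonneg (hz i) (hp i)
end

section
/- Consider the linear program p* = max{cᵀx : Ax = b, x ≥ 0} with A ∈ ℝ^{m×n}, b ∈ ℝ^m, c ∈ ℝ^n, nonempty feasible set, and finite optimal value p*. For R > 0 let x*(R) denote the unique minimizer of (1/2)‖x − Rc‖² over {x : Ax = b, x ≥ 0}. Then a point x* is the minimum-norm optimal solution of the linear program (i.e., the optimal solution of least Euclidean norm) if and only if there exists R̄ > 0 such that x* = x*(R) for all R ≥ R̄. -/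
open Matrix BigOperators

/-- The **Farkas lemma** for finitely many linear functionals. -/
theorem exists_nonneg_sum_smul_eq_of_forall_nonneg {ι V : Type*} [AddCommGroup V] [Module ℝ V]
    (s : Finset ι) (f : ι → V →ₗ[ℝ] ℝ) (g : V →ₗ[ℝ] ℝ)
    (h : ∀ x, (∀ i ∈ s, 0 ≤ f i x) → 0 ≤ g x) :
    ∃ μ : ι → ℝ, (∀ i, 0 ≤ μ i) ∧ g = ∑ i ∈ s, μ i • f i := by
  classical
  induction s using Finset.induction_on generalizing f g with
  | empty =>
    refine ⟨0, by simp, ?_⟩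
    ext x
    have h₁ := h x (by simp)
    have h₂ := h (-x) (by simp)
    simp only [map_neg] at h₂
    simp only [Finset.sum_empty, LinearMap.zero_apply]
    linarith
  | insert a s ha ih =>
    have extend : ∀ (t : ℝ) (μ : ι → ℝ), 0 ≤ t → (∀ i, 0 ≤ μ i) →
        g = t • f a + ∑ i ∈ s, μ i • f i →
        ∃ ν : ι → ℝ, (∀ i, 0 ≤ ν i) ∧ g = ∑ i ∈ insert a s, ν i • f i := by
      intro t μ ht hμ hg
      refine ⟨Function.update μ a t, fun i => ?_, ?_⟩
      · by_cases hi : i = a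
        · simpa [hi] using ht
        · simpa [hi] using hμ i
      · rw [Finset.sum_insert ha, hg, Function.update_self]
        congr 1
        refine Finset.sum_congr rfl fun i hi => ?_
        rw [Function.update_of_ne (ne_of_mem_of_not_mem hi ha)]
    by_cases hs : ∀ x, (∀ i ∈ s, 0 ≤ f i x) → 0 ≤ g x
    · obtain ⟨μ, hμ, hg⟩ := ih f g hs
      exact extend 0 μ le_rfl hμ (by simpa using hg)
    push Not at hs
    obtain ⟨y, hy, hgy⟩ := hs
    have hay : f a y < 0 := by
      by_contra! hay
      exact hgy.not_ge (h y (by simpa using ⟨hay, hy⟩))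
    -- Normalise `y` so that `x ↦ x + f a x • z` maps into the kernel of `f a`.
    obtain ⟨z, hz, hgz, haz⟩ : ∃ z, (∀ i ∈ s, 0 ≤ f i z) ∧ g z ≤ 0 ∧ f a z = -1 := by
      have hpos : 0 ≤ (-f a y)⁻¹ := inv_nonneg.2 (by linarith)
      refine ⟨(-f a y)⁻¹ • y, fun i hi => ?_, ?_, ?_⟩
      · simpa only [map_smul, smul_eq_mul] using mul_nonneg hpos (hy i hi)
      · simpa only [map_smul, smul_eq_mul] using mul_nonpos_of_nonneg_of_nonpos hpos hgy.le
      · rw [map_smul, smul_eq_mul]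
        rw [inv_neg, neg_mul, inv_mul_cancel₀ hay.ne]
    obtain ⟨μ, hμ, hg⟩ := ih (fun i => f i + f i z • f a) (g + g z • f a) fun x hx => by
      have hproj := h (x + f a x • z) (by
        simp only [Finset.mem_insert, forall_eq_or_imp, map_add, map_smul, smul_eq_mul, haz]
        refine ⟨by linarith, fun i hi => ?_⟩
        have := hx i hi
        simp only [LinearMap.add_apply, LinearMap.smul_apply, smul_eq_mul] at this
        linarith)
      simp only [map_add, map_smul, smul_eq_mul] at hproj
      simp only [LinearMap.add_apply, LinearMap.smul_apply, smul_eq_mul]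
      linarith
    refine extend (∑ i ∈ s, μ i * f i z - g z) μ ?_ hμ ?_
    · have := Finset.sum_nonneg fun i hi => mul_nonneg (hμ i) (hz i hi)
      linarith
    · simp only [smul_add, Finset.sum_add_distrib, smul_smul, ← Finset.sum_smul] at hg
      ext x
      have hx := LinearMap.congr_fun hg x
      simp only [LinearMap.add_apply, LinearMap.smul_apply, smul_eq_mul] at hx ⊢
      linarith

/-- If moving from a nonnegative vector along `d` keeps the coordinates that vanish nonnegative,
then short steps stay in the nonnegative orthant. -/
theorem eventually_nonneg_add_smul {n : ℕ} {x d : Fin n → ℝ} (hx : ∀ i, 0 ≤ x i)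
    (hd : ∀ i, x i = 0 → 0 ≤ d i) :
    ∀ᶠ ε in nhdsWithin (0 : ℝ) (Set.Ioi 0), ∀ i, 0 ≤ (x + ε • d) i := by
  refine Filter.eventually_all.2 fun i => ?_
  rcases (hx i).eq_or_lt with hi | hi
  · filter_upwards [self_mem_nhdsWithin] with ε hε
    simpa [← hi] using mul_nonneg (le_of_lt hε) (hd i hi.symm)
  · have hc : Continuous fun ε : ℝ => (x + ε • d) i := by
      simp only [Pi.add_apply, Pi.smul_apply, smul_eq_mul]
      fun_prop
    have := (hc.tendsto 0).eventually_const_lt (u := 0) (by simpa using hi)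
    exact (this.filter_mono nhdsWithin_le_nhds).mono fun _ => le_of_lt

/-- If short steps along `d` do not decrease the norm of `x`, then `d` is not a descent direction. -/
theorem dotProduct_nonneg_of_eventually_le {n : ℕ} {x d : Fin n → ℝ}
    (h : ∀ᶠ ε in nhdsWithin (0 : ℝ) (Set.Ioi 0), x ⬝ᵥ x ≤ (x + ε • d) ⬝ᵥ (x + ε • d)) :
    0 ≤ x ⬝ᵥ d := by
  have hc : Filter.Tendsto (fun ε : ℝ => 2 * (x ⬝ᵥ d) + ε * (d ⬝ᵥ d))
      (nhdsWithin (0 : ℝ) (Set.Ioi 0)) (nhds (2 * (x ⬝ᵥ d))) := by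
    have hcont : Continuous fun ε : ℝ => 2 * (x ⬝ᵥ d) + ε * (d ⬝ᵥ d) := by fun_prop
    simpa using (hcont.tendsto 0).mono_left nhdsWithin_le_nhds
  have := ge_of_tendsto hc (b := 0) (by
    filter_upwards [h, self_mem_nhdsWithin] with ε hε hpos
    simp only [add_dotProduct, dotProduct_add, smul_dotProduct, dotProduct_smul, smul_eq_mul,
      dotProduct_comm d x] at hε
    refine nonneg_of_mul_nonneg_right (a := ε) ?_ hpos
    linarith)
  linarith

/-- A multiplier for the objective constraint in the problem of minimising the norm over the
optimal face of a linear program. -/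
theorem exists_multiplier_of_min_norm {m n : ℕ} (A : Matrix (Fin m) (Fin n) ℝ) (b : Fin m → ℝ)
    (c : Fin n → ℝ) {xstar : Fin n → ℝ} (hA : A *ᵥ xstar = b) (hnn : ∀ i, 0 ≤ xstar i)
    (hmin : ∀ x, A *ᵥ x = b → (∀ i, 0 ≤ x i) → c ⬝ᵥ xstar ≤ c ⬝ᵥ x →
      xstar ⬝ᵥ xstar ≤ x ⬝ᵥ x) :
    ∃ l : ℝ, 0 ≤ l ∧ ∀ x, A *ᵥ x = b → (∀ i, 0 ≤ x i) →
      l * (c ⬝ᵥ (x - xstar)) ≤ xstar ⬝ᵥ (x - xstar) := by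
  classical
  let K := LinearMap.ker A.mulVecLin
  let φ : (Fin n → ℝ) → K →ₗ[ℝ] ℝ := fun v => dotProductBilin ℝ ℝ v ∘ₗ K.subtype
  have hφ : ∀ v (d : K), φ v d = v ⬝ᵥ (d : Fin n → ℝ) := fun _ _ => rfl
  let f : Option (Fin n) → K →ₗ[ℝ] ℝ := fun o => o.elim (φ c) fun i => φ (Pi.single i 1)
  let s := Finset.insertNone (Finset.univ.filter fun i => xstar i = 0)
  obtain ⟨μ, hμ, hg⟩ := exists_nonneg_sum_smul_eq_of_forall_nonneg s f (φ xstar) (by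
    rintro ⟨d, hd⟩ hf
    have hAd : A *ᵥ d = 0 := hd
    simp only [s, Finset.forall_mem_insertNone, f, Option.elim, hφ, Finset.mem_filter,
      Finset.mem_univ, true_and, single_one_dotProduct] at hf
    refine dotProduct_nonneg_of_eventually_le (d := d) ?_
    filter_upwards [eventually_nonneg_add_smul hnn hf.2, self_mem_nhdsWithin] with ε hε hpos
    refine hmin _ ?_ hε ?_
    · rw [mulVec_add, mulVec_smul, hAd, hA, smul_zero, add_zero]
    · rw [dotProduct_add, dotProduct_smul, smul_eq_mul]
      linarith [mul_nonneg (le_of_lt hpos) hf.1])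
  refine ⟨μ none, hμ none, fun x hx hxnn => ?_⟩
  have hmem : x - xstar ∈ K := by
    simp [K, mulVec_sub, hx, hA]
  have key := LinearMap.congr_fun hg ⟨x - xstar, hmem⟩
  simp only [s, Finset.sum_insertNone, f, Option.elim, LinearMap.add_apply, LinearMap.sum_apply,
    LinearMap.smul_apply, smul_eq_mul, hφ, single_one_dotProduct] at key
  rw [key]
  refine le_add_of_nonneg_right (Finset.sum_nonneg fun i hi => mul_nonneg (hμ _) ?_)
  simpa [(Finset.mem_filter.1 hi).2] using hxnn i

theorem sum_sub_mul_sq {n : ℕ} (x c : Fin n → ℝ) (R : ℝ) :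
    ∑ i, (x i - R * c i) ^ 2 = x ⬝ᵥ x - 2 * R * (c ⬝ᵥ x) + R ^ 2 * (c ⬝ᵥ c) := by
  simp only [dotProduct, Finset.mul_sum, ← Finset.sum_sub_distrib, ← Finset.sum_add_distrib]
  exact Finset.sum_congr rfl fun i _ => by ring

/-- For the LP max{cᵀx : Ax = b, x ≥ 0} with nonempty feasible set and finite
    optimal value, x* is the minimum-norm optimal solution iff there is R̄ > 0 such
    that for all R ≥ R̄, x* is the (unique) minimizer of (1/2)‖x − Rc‖² over the
    feasible set, i.e. x* = x*(R). -/
theorem stmt11 {m n : ℕ} (A : Matrix (Fin m) (Fin n) ℝ) (b : Fin m → ℝ) (c : Fin n → ℝ)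
    (hfeas : ∃ x : Fin n → ℝ, A.mulVec x = b ∧ ∀ i, 0 ≤ x i)
    (hfinite : ∃ M : ℝ, ∀ x : Fin n → ℝ, A.mulVec x = b → (∀ i, 0 ≤ x i) → c ⬝ᵥ x ≤ M)
    (xstar : Fin n → ℝ) :
    ((A.mulVec xstar = b ∧ ∀ i, 0 ≤ xstar i) ∧
      (∀ x : Fin n → ℝ, A.mulVec x = b → (∀ i, 0 ≤ x i) → c ⬝ᵥ x ≤ c ⬝ᵥ xstar) ∧
      (∀ x : Fin n → ℝ, A.mulVec x = b → (∀ i, 0 ≤ x i) →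
        (∀ x' : Fin n → ℝ, A.mulVec x' = b → (∀ i, 0 ≤ x' i) → c ⬝ᵥ x' ≤ c ⬝ᵥ x) →
        x ≠ xstar → ∑ i, (xstar i)^2 < ∑ i, (x i)^2)) ↔
    (∃ Rbar : ℝ, 0 < Rbar ∧ ∀ R : ℝ, Rbar ≤ R →
      (A.mulVec xstar = b ∧ ∀ i, 0 ≤ xstar i) ∧
      ∀ x : Fin n → ℝ, A.mulVec x = b → (∀ i, 0 ≤ x i) → x ≠ xstar →
        ∑ i, (xstar i - R * c i)^2 < ∑ i, (x i - R * c i)^2) := by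
  have hsq : ∀ x : Fin n → ℝ, ∑ i, (x i) ^ 2 = x ⬝ᵥ x := fun x => by
    simp only [dotProduct, sq]
  simp only [sum_sub_mul_sq]
  simp only [hsq]
  constructor
  · rintro ⟨⟨hA, hnn⟩, hopt, hmin⟩
    obtain ⟨l, hl, hmul⟩ := exists_multiplier_of_min_norm A b c hA hnn fun x hx hxnn hcx => by
      by_cases hne : x = xstar
      · rw [hne]
      · exact (hmin x hx hxnn (fun y hy hynn => (hopt y hy hynn).trans hcx) hne).le
    refine ⟨l + 1, by linarith, fun R hR => ⟨⟨hA, hnn⟩, fun x hx hxnn hne => ?_⟩⟩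
    have hpos : 0 < (x - xstar) ⬝ᵥ (x - xstar) :=
      lt_of_le_of_ne (Finset.sum_nonneg fun i _ => mul_self_nonneg _)
        fun h => hne (sub_eq_zero.1 (dotProduct_self_eq_zero.1 h.symm))
    have hfirst := hmul x hx hxnn
    have hgap := mul_nonneg (show 0 ≤ R - l by linarith) (sub_nonneg.2 (hopt x hx hxnn))
    simp only [sub_dotProduct, dotProduct_sub, dotProduct_comm x xstar] at hpos hfirst
    linarith
  · rintro ⟨Rbar, hRbar, h⟩
    have hfeas' := (h Rbar le_rfl).1
    refine ⟨hfeas', fun x hx hxnn => ?_, fun x hx hxnn hxopt hne => ?_⟩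
    · by_contra! hlt
      have hne : x ≠ xstar := by
        rintro rfl
        exact hlt.false
      have hδ : 0 < c ⬝ᵥ x - c ⬝ᵥ xstar := sub_pos.2 hlt
      obtain ⟨R, hR, hRδ⟩ : ∃ R, Rbar ≤ R ∧ x ⬝ᵥ x - xstar ⬝ᵥ xstar ≤
          2 * R * (c ⬝ᵥ x - c ⬝ᵥ xstar) := by
        refine ⟨max Rbar ((x ⬝ᵥ x - xstar ⬝ᵥ xstar) / (2 * (c ⬝ᵥ x - c ⬝ᵥ xstar))),
          le_max_left _ _, ?_⟩
        have := (div_le_iff₀ (by linarith)).1 (le_max_right Rbar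
          ((x ⬝ᵥ x - xstar ⬝ᵥ xstar) / (2 * (c ⬝ᵥ x - c ⬝ᵥ xstar))))
        linarith
      have := (h R hR).2 x hx hxnn hne
      linarith
    · have hlt := (h Rbar le_rfl).2 x hx hxnn hne
      have := mul_nonneg hRbar.le (sub_nonneg.2 (hxopt xstar hfeas'.1 hfeas'.2))
      linarith
end

section
/- Let A ∈ ℝ^{m×n}, b ∈ ℝ^m, c ∈ ℝ^n, and R, R' > 0. Suppose (w, y, z) ∈ ℝ^n × ℝ^m × ℝ^n satisfies the optimality conditions w − c − Aᵀy − z = 0, Aw = (1/R)b, w ≥ 0, z ≥ 0, zᵀw = 0. Let B = {i : w_i > 0}, N = {i : z_i > 0}. Suppose Δy ∈ ℝ^m satisfies (AᵀΔy)_i = 0 for all i ∉ B ∪ N; define Δw ∈ ℝ^n by Δw_i = (AᵀΔy)_i for i ∈ B and Δw_i = 0 otherwise, and Δz ∈ ℝ^n by Δz_i = −(AᵀΔy)_i for i ∈ N and Δz_i = 0 otherwise. If A Δw = (1/R' − 1/R) b, w + Δw ≥ 0, and z + Δz ≥ 0, then (w + Δw, y + Δy, z + Δz) satisfies the optimality conditions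 for parameter R': (w+Δw) − c − Aᵀ(y+Δy) − (z+Δz) = 0, A(w+Δw) = (1/R')b, w+Δw ≥ 0, z+Δz ≥ 0, and (z+Δz)ᵀ(w+Δw) = 0. -/
open Matrix BigOperators

/-- Sensitivity-analysis step of the stepping stone external path following
    algorithm: the updated triple (w+Δw, y+Δy, z+Δz) satisfies the optimality
    conditions for the new parameter R'. -/
theorem stmt13 {m n : ℕ} (A : Matrix (Fin m) (Fin n) ℝ) (b : Fin m → ℝ) (c : Fin n → ℝ)
    (R R' : ℝ) (hR : 0 < R) (hR' : 0 < R')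
    (w : Fin n → ℝ) (y : Fin m → ℝ) (z : Fin n → ℝ)
    (hdual : w - c - Aᵀ.mulVec y - z = 0)
    (hprimal : A.mulVec w = R⁻¹ • b)
    (hw : ∀ i, 0 ≤ w i) (hz : ∀ i, 0 ≤ z i) (hcs : z ⬝ᵥ w = 0)
    (Δy : Fin m → ℝ)
    (hΔy0 : ∀ i, ¬ 0 < w i → ¬ 0 < z i → Aᵀ.mulVec Δy i = 0)
    (Δw : Fin n → ℝ)
    (hΔw : ∀ i, Δw i = if 0 < w i then Aᵀ.mulVec Δy i else 0)
    (Δz : Fin n → ℝ)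
    (hΔz : ∀ i, Δz i = if 0 < z i then -(Aᵀ.mulVec Δy i) else 0)
    (hAΔw : A.mulVec Δw = (R'⁻¹ - R⁻¹) • b)
    (hwnew : ∀ i, 0 ≤ w i + Δw i) (hznew : ∀ i, 0 ≤ z i + Δz i) :
    (w + Δw) - c - Aᵀ.mulVec (y + Δy) - (z + Δz) = 0 ∧
    A.mulVec (w + Δw) = R'⁻¹ • b ∧
    (∀ i, 0 ≤ (w + Δw) i) ∧ (∀ i, 0 ≤ (z + Δz) i) ∧
    (z + Δz) ⬝ᵥ (w + Δw) = 0 := by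
  have hzw : ∀ i, z i * w i = 0 := fun i =>
    (Finset.sum_eq_zero_iff_of_nonneg fun j _ => mul_nonneg (hz j) (hw j)).1 hcs i
      (Finset.mem_univ i)
  have hcases : ∀ i, (0 < w i ∧ z i = 0) ∨ (w i = 0 ∧ 0 < z i) ∨ (w i = 0 ∧ z i = 0) := by
    intro i
    rcases mul_eq_zero.1 (hzw i) with h | h <;>
      rcases (hw i).lt_or_eq with h1 | h1 <;> rcases (hz i).lt_or_eq with h2 | h2 <;> grind
  refine ⟨?_, ?_, hwnew, hznew, ?_⟩
  · ext i
    have hd := congrFun hdual i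
    have h0 := hΔy0 i
    have h1 := hΔw i
    have h2 := hΔz i
    simp only [mulVec_add, Pi.sub_apply, Pi.add_apply, Pi.zero_apply] at hd ⊢
    rcases hcases i with ⟨h, h'⟩ | ⟨h, h'⟩ | ⟨h, h'⟩ <;> grind
  · rw [mulVec_add, hprimal, hAΔw, ← add_smul, add_sub_cancel]
  · refine Finset.sum_eq_zero fun i _ => ?_
    have h1 := hΔw i
    have h2 := hΔz i
    simp only [Pi.add_apply]
    rcases hcases i with ⟨h, h'⟩ | ⟨h, h'⟩ | ⟨h, h'⟩ <;> simp [h1, h2, h, h']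
end

section
/- Let n = n₁ + n₂, A ∈ ℝ^{m×n}, b ∈ ℝ^m, v ∈ ℝ^n, and write each x ∈ ℝ^n as x = (x₁, x₂) with x₁ ∈ ℝ^{n₁}, x₂ ∈ ℝ^{n₂}. Suppose Q = {x ∈ ℝ^n : Ax = b, x₁ ≥ 0} is nonempty. Then the minimizer of (1/2)‖x − v‖² over Q exists and is unique. Moreover, defining F_f(y) = A·((v+Aᵀy)₁₊, (v+Aᵀy)₂) − b (positive part taken only in the first n₁ components), if F_f(y) = 0 for some y ∈ ℝ^m, then x = ((v+Aᵀy)₁₊, (v+Aᵀy)₂) is this unique minimizer, i.e., the projection of v onto Q. -/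
open Matrix BigOperators

/-- The variational inequality at `p` makes `p` strictly closer to `v` than `x`. -/
theorem sum_sq_sub_lt_of_sum_mul_nonneg {ι : Type*} [Fintype ι] {p v x : ι → ℝ}
    (h : 0 ≤ ∑ j, (p j - v j) * (x j - p j)) (hne : x ≠ p) :
    ∑ j, (p j - v j) ^ 2 < ∑ j, (x j - v j) ^ 2 := by
  have hpos : 0 < ∑ j, (x j - p j) ^ 2 := by
    obtain ⟨i, hi⟩ := Function.ne_iff.mp hne
    exact Finset.sum_pos' (fun j _ => sq_nonneg _)
      ⟨i, Finset.mem_univ i, sq_pos_of_ne_zero (sub_ne_zero.mpr hi)⟩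
  have hexpand : ∑ j, (x j - v j) ^ 2 = ∑ j, (p j - v j) ^ 2 +
      2 * ∑ j, (p j - v j) * (x j - p j) + ∑ j, (x j - p j) ^ 2 := by
    rw [Finset.mul_sum, ← Finset.sum_add_distrib, ← Finset.sum_add_distrib]
    exact Finset.sum_congr rfl fun j _ => by ring
  linarith

/-- A nonempty closed convex set contains a point satisfying the variational inequality
characterizing the projection of `v`. -/
theorem exists_mem_sum_mul_nonneg {ι : Type*} [Fintype ι] {S : Set (ι → ℝ)}
    (hne : S.Nonempty) (hclosed : IsClosed S) (hconv : Convex ℝ S) (v : ι → ℝ) :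
    ∃ p ∈ S, ∀ x ∈ S, 0 ≤ ∑ j, (p j - v j) * (x j - p j) := by
  let e : EuclideanSpace ℝ ι ≃L[ℝ] (ι → ℝ) := EuclideanSpace.equiv ι ℝ
  have hconv' : Convex ℝ (e ⁻¹' S) := hconv.linear_preimage e.toLinearEquiv.toLinearMap
  obtain ⟨p, hp, hmin⟩ := exists_norm_eq_iInf_of_complete_convex
    (hne.preimage e.surjective) (hclosed.preimage e.continuous).isComplete hconv' (e.symm v)
  rw [norm_eq_iInf_iff_real_inner_le_zero hconv' hp] at hmin
  refine ⟨e p, hp, fun x hx => ?_⟩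
  have h := hmin (e.symm x) (by simpa using hx)
  rw [PiLp.inner_apply, ← neg_nonneg, ← Finset.sum_neg_distrib] at h
  refine h.trans_eq (Finset.sum_congr rfl fun j _ => ?_)
  simp [e]
  ring

/-- Best approximation with free variables: the minimizer of (1/2)‖x − v‖² over
    Q = {x : Ax = b, x₁ ≥ 0} exists and is unique, and if
    F_f(y) = A((v+Aᵀy)₁₊, (v+Aᵀy)₂) − b = 0 then x = ((v+Aᵀy)₁₊, (v+Aᵀy)₂) is
    this unique minimizer. -/
theorem stmt15 {m n₁ n₂ : ℕ} (A : Matrix (Fin m) (Fin n₁ ⊕ Fin n₂) ℝ)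
    (b : Fin m → ℝ) (v : Fin n₁ ⊕ Fin n₂ → ℝ)
    (hQ : ∃ x : Fin n₁ ⊕ Fin n₂ → ℝ, A.mulVec x = b ∧ ∀ i : Fin n₁, 0 ≤ x (Sum.inl i)) :
    (∃ xstar : Fin n₁ ⊕ Fin n₂ → ℝ,
      (A.mulVec xstar = b ∧ ∀ i : Fin n₁, 0 ≤ xstar (Sum.inl i)) ∧
      ∀ x : Fin n₁ ⊕ Fin n₂ → ℝ, A.mulVec x = b → (∀ i : Fin n₁, 0 ≤ x (Sum.inl i)) →
        x ≠ xstar → ∑ j, (xstar j - v j)^2 < ∑ j, (x j - v j)^2) ∧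
    (∀ y : Fin m → ℝ,
      A.mulVec (Sum.elim (fun i => max 0 (v (Sum.inl i) + Aᵀ.mulVec y (Sum.inl i)))
                         (fun i => v (Sum.inr i) + Aᵀ.mulVec y (Sum.inr i))) = b →
      ∀ x : Fin n₁ ⊕ Fin n₂ → ℝ, A.mulVec x = b → (∀ i : Fin n₁, 0 ≤ x (Sum.inl i)) →
        x ≠ Sum.elim (fun i => max 0 (v (Sum.inl i) + Aᵀ.mulVec y (Sum.inl i)))
                     (fun i => v (Sum.inr i) + Aᵀ.mulVec y (Sum.inr i)) →
        ∑ j, (Sum.elim (fun i => max 0 (v (Sum.inl i) + Aᵀ.mulVec y (Sum.inl i)))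
                       (fun i => v (Sum.inr i) + Aᵀ.mulVec y (Sum.inr i)) j - v j)^2
          < ∑ j, (x j - v j)^2) := by
  constructor
  · let S : Set (Fin n₁ ⊕ Fin n₂ → ℝ) := {x | A.mulVec x = b ∧ ∀ i : Fin n₁, 0 ≤ x (Sum.inl i)}
    have hclosed : IsClosed S := by
      have hnonneg : IsClosed {x : Fin n₁ ⊕ Fin n₂ → ℝ | ∀ i : Fin n₁, 0 ≤ x (Sum.inl i)} := by
        rw [Set.ofPred_forall]
        exact isClosed_iInter fun i => isClosed_le continuous_const (continuous_apply _)
      exact (isClosed_eq (by fun_prop) continuous_const).inter hnonneg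
    have hconv : Convex ℝ S := by
      rintro x ⟨hx, hx'⟩ z ⟨hz, hz'⟩ s t hs ht hst
      refine ⟨?_, fun i => ?_⟩
      · rw [mulVec_add, mulVec_smul, mulVec_smul, hx, hz, ← add_smul, hst, one_smul]
      · exact add_nonneg (mul_nonneg hs (hx' i)) (mul_nonneg ht (hz' i))
    obtain ⟨p, hp, hvar⟩ := exists_mem_sum_mul_nonneg hQ hclosed hconv v
    exact ⟨p, hp, fun x hx hx' hne => sum_sq_sub_lt_of_sum_mul_nonneg (hvar x ⟨hx, hx'⟩) hne⟩
  · intro y hy x hx hx' hne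
    refine sum_sq_sub_lt_of_sum_mul_nonneg ?_ hne
    set p : Fin n₁ ⊕ Fin n₂ → ℝ :=
      Sum.elim (fun i => max 0 (v (Sum.inl i) + Aᵀ.mulVec y (Sum.inl i)))
        (fun i => v (Sum.inr i) + Aᵀ.mulVec y (Sum.inr i)) with hp
    have horth : ∑ j, Aᵀ.mulVec y j * (x j - p j) = 0 := by
      change Aᵀ.mulVec y ⬝ᵥ (x - p) = 0
      rw [mulVec_transpose, ← dotProduct_mulVec, mulVec_sub, hx, hy, sub_self, dotProduct_zero]
    rw [← horth]
    refine Finset.sum_le_sum fun j _ => ?_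
    rcases j with i | i
    · simp only [hp, Sum.elim_inl]
      rcases max_cases (0 : ℝ) (v (Sum.inl i) + Aᵀ.mulVec y (Sum.inl i)) with ⟨h, h'⟩ | ⟨h, h'⟩
      · rw [h]
        nlinarith [hx' i]
      · rw [h, add_sub_cancel_left]
    · simp only [hp, Sum.elim_inr, add_sub_cancel_left, le_refl]
end

section
/- Let n = n₁ + n₂, A ∈ ℝ^{m×n}, b ∈ ℝ^m, v ∈ ℝ^n, with Q = {x ∈ ℝ^n : Ax = b, x₁ ≥ 0} nonempty, where x = (x₁, x₂) with x₁ ∈ ℝ^{n₁}. Then strong duality holds for the best approximation problem with free variables: min_{x ∈ Q} (1/2)‖x − v‖² equals the maximum over y ∈ ℝ^m and z₁ ∈ ℝ^{n₁} with z₁ ≥ 0 of φ_f(y, z₁) = −(1/2)‖(z₁, 0) + Aᵀy‖² + yᵀ(b − Av) − z₁ᵀv₁, and this maximum is attained. -/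
open Matrix BigOperators

/-- Farkas' lemma for a finite family of linear functionals on a real vector space. -/
theorem exists_nonneg_sum_smul_of_nonneg {V ι : Type*} [AddCommGroup V] [Module ℝ V]
    (s : Finset ι) (a : ι → V →ₗ[ℝ] ℝ) (c : V →ₗ[ℝ] ℝ)
    (h : ∀ x, (∀ i ∈ s, 0 ≤ a i x) → 0 ≤ c x) :
    ∃ l : ι → ℝ, (∀ i, 0 ≤ l i) ∧ c = ∑ i ∈ s, l i • a i := by
  classical
  induction s using Finset.induction_on generalizing a c with
  | empty =>
    refine ⟨0, fun _ => le_rfl, LinearMap.ext fun x => ?_⟩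
    have h1 := h x (by simp)
    have h2 := h (-x) (by simp)
    rw [map_neg] at h2
    simp only [Finset.sum_empty, LinearMap.zero_apply]
    linarith
  | insert k s hk ih =>
    by_cases hc : ∀ x, (∀ i ∈ s, 0 ≤ a i x) → 0 ≤ c x
    · obtain ⟨l, hl, rfl⟩ := ih a c hc
      refine ⟨Function.update l k 0, fun i => ?_, ?_⟩
      · by_cases hi : i = k
        · simp [hi]
        · simpa [hi] using hl i
      · rw [Finset.sum_insert hk]
        simp only [Function.update_self, zero_smul, zero_add]
        refine Finset.sum_congr rfl fun i hi => ?_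
        rw [Function.update_of_ne (ne_of_mem_of_not_mem hi hk)]
    · push Not at hc
      obtain ⟨x₁, hx₁, hcx₁⟩ := hc
      have hak : a k x₁ < 0 := by
        by_contra! hcon
        exact absurd (h x₁ (by simpa [hcon] using hx₁)) (not_le.mpr hcx₁)
      obtain ⟨x₀, hx₀, hcx₀, hk₀⟩ :
          ∃ x₀, (∀ i ∈ s, 0 ≤ a i x₀) ∧ c x₀ < 0 ∧ a k x₀ = -1 := by
        have hpos : 0 < (-a k x₁)⁻¹ := inv_pos.mpr (by linarith)
        refine ⟨(-a k x₁)⁻¹ • x₁, fun i hi => ?_, ?_, ?_⟩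
        · simpa using mul_nonneg hpos.le (hx₁ i hi)
        · simpa using mul_neg_of_pos_of_neg hpos hcx₁
        · rw [map_smul, smul_eq_mul, inv_neg, neg_mul, inv_mul_cancel₀ hak.ne]
      obtain ⟨l, hl, hcl⟩ := ih (fun i => a i + a i x₀ • a k) (c + c x₀ • a k) (by
        intro x hx
        have := h (x + a k x • x₀) (by
          intro i hi
          rcases Finset.mem_insert.mp hi with rfl | hi
          · simp [hk₀]
          · simpa [mul_comm] using hx i hi)
        simpa [mul_comm] using this)
      refine ⟨Function.update l k (∑ i ∈ s, l i * a i x₀ - c x₀), fun i => ?_, ?_⟩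
      · by_cases hi : i = k
        · have := Finset.sum_nonneg fun i hi => mul_nonneg (hl i) (hx₀ i hi)
          simp only [hi, Function.update_self]
          linarith
        · simpa [hi] using hl i
      · rw [Finset.sum_insert hk, Function.update_self]
        have hs : ∑ i ∈ s, Function.update l k (∑ i ∈ s, l i * a i x₀ - c x₀) i • a i
            = ∑ i ∈ s, l i • a i :=
          Finset.sum_congr rfl fun i hi => by
            rw [Function.update_of_ne (ne_of_mem_of_not_mem hi hk)]
        rw [hs]
        ext x
        have hx := LinearMap.congr_fun hcl x
        simp only [LinearMap.add_apply, LinearMap.smul_apply, LinearMap.sum_apply, smul_eq_mul,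
          mul_add, Finset.sum_add_distrib, ← mul_assoc, ← Finset.sum_mul] at hx ⊢
        linarith

/-- A nonempty closed set has a point minimising the sum of squared deviations from `v`. -/
theorem IsClosed.exists_forall_sum_sq_le {ι : Type*} [Fintype ι] {s : Set (ι → ℝ)}
    (hs : IsClosed s) (hne : s.Nonempty) (v : ι → ℝ) :
    ∃ x ∈ s, ∀ y ∈ s, ∑ j, (x j - v j) ^ 2 ≤ ∑ j, (y j - v j) ^ 2 := by
  have hs' : IsClosed ((WithLp.ofLp : EuclideanSpace ℝ ι → ι → ℝ) ⁻¹' s) :=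
    hs.preimage (PiLp.continuous_ofLp 2 _)
  obtain ⟨x₀, hx₀⟩ := hne
  obtain ⟨x, hx, hd⟩ := hs'.exists_infDist_eq_dist ⟨WithLp.toLp 2 x₀, hx₀⟩ (WithLp.toLp 2 v)
  refine ⟨x.ofLp, hx, fun y hy => ?_⟩
  have hle : dist (WithLp.toLp 2 v) x ≤ dist (WithLp.toLp 2 v) (WithLp.toLp 2 y) :=
    hd ▸ Metric.infDist_le_dist_of_mem (show WithLp.toLp 2 y ∈ WithLp.ofLp ⁻¹' s from hy)
  rw [dist_comm, dist_comm _ (WithLp.toLp 2 y), EuclideanSpace.dist_eq, EuclideanSpace.dist_eq,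
    Real.sqrt_le_sqrt_iff (Finset.sum_nonneg fun _ _ => sq_nonneg _)] at hle
  simpa [Real.dist_eq, sq_abs] using hle

/-- First-order optimality along a feasible direction `d`. -/
theorem sum_mul_nonneg_of_eventually_sum_sq_le {ι : Type*} [Fintype ι] (u d : ι → ℝ)
    (h : ∀ᶠ t : ℝ in nhdsWithin 0 (Set.Ioi 0), ∑ j, u j ^ 2 ≤ ∑ j, (u j + t * d j) ^ 2) :
    0 ≤ ∑ j, u j * d j := by
  have hlim : Filter.Tendsto (fun t : ℝ => 2 * ∑ j, u j * d j + t * ∑ j, d j ^ 2)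
      (nhdsWithin 0 (Set.Ioi 0)) (nhds (2 * ∑ j, u j * d j + 0 * ∑ j, d j ^ 2)) :=
    (Continuous.tendsto (by fun_prop) 0).mono_left nhdsWithin_le_nhds
  have hge := ge_of_tendsto (b := 0) hlim (by
    filter_upwards [h, self_mem_nhdsWithin] with t ht htpos
    have hexp : ∑ j, (u j + t * d j) ^ 2
        = ∑ j, u j ^ 2 + t * (2 * ∑ j, u j * d j + t * ∑ j, d j ^ 2) := by
      simp only [Finset.mul_sum, ← Finset.sum_add_distrib]
      exact Finset.sum_congr rfl fun j _ => by ring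
    rw [hexp] at ht
    exact nonneg_of_mul_nonneg_right (by linarith) htpos)
  linarith

/-- The gap between the primal and the dual objective. -/
theorem primal_sub_dual_eq {m n₁ n₂ : ℕ} (A : Matrix (Fin m) (Fin n₁ ⊕ Fin n₂) ℝ)
    (b : Fin m → ℝ) (v x : Fin n₁ ⊕ Fin n₂ → ℝ) (hx : A.mulVec x = b)
    (y : Fin m → ℝ) (z : Fin n₁ → ℝ) :
    (1/2) * ∑ j, (x j - v j)^2 -
      (-(1/2) * ∑ j, (Sum.elim z (fun _ => (0:ℝ)) j + Aᵀ.mulVec y j)^2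
          + y ⬝ᵥ (b - A.mulVec v) - ∑ i, z i * v (Sum.inl i)) =
      (1/2) * ∑ j, (x j - v j - (Sum.elim z (fun _ => (0:ℝ)) j + Aᵀ.mulVec y j))^2
        + ∑ i, z i * x (Sum.inl i) := by
  have h1 : y ⬝ᵥ (b - A.mulVec v) = ∑ j, Aᵀ.mulVec y j * (x j - v j) := by
    rw [← hx, ← Matrix.mulVec_sub, Matrix.dotProduct_mulVec, Matrix.mulVec_transpose]
    rfl
  have h2 : ∑ i, z i * x (Sum.inl i) - ∑ i, z i * v (Sum.inl i)
      = ∑ j, Sum.elim z (fun _ => (0:ℝ)) j * (x j - v j) := by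
    simp [Fintype.sum_sum_type, mul_sub]
  have h3 : ∑ j, (x j - v j - (Sum.elim z (fun _ => (0:ℝ)) j + Aᵀ.mulVec y j))^2
      = ∑ j, (x j - v j)^2 + ∑ j, (Sum.elim z (fun _ => (0:ℝ)) j + Aᵀ.mulVec y j)^2
        - 2 * (∑ j, Sum.elim z (fun _ => (0:ℝ)) j * (x j - v j)
          + ∑ j, Aᵀ.mulVec y j * (x j - v j)) := by
    simp only [Finset.mul_sum, ← Finset.sum_add_distrib, ← Finset.sum_sub_distrib]
    exact Finset.sum_congr rfl fun j _ => by ring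
  rw [h1, h3, ← h2]
  ring

/-- Karush–Kuhn–Tucker multipliers at the projection of `v` onto the polyhedron. -/
theorem exists_multipliers_of_forall_sum_sq_le {m n₁ n₂ : ℕ}
    (A : Matrix (Fin m) (Fin n₁ ⊕ Fin n₂) ℝ) (b : Fin m → ℝ) (v x : Fin n₁ ⊕ Fin n₂ → ℝ)
    (hx : A.mulVec x = b) (hx₀ : ∀ i : Fin n₁, 0 ≤ x (Sum.inl i))
    (hmin : ∀ x', A.mulVec x' = b → (∀ i : Fin n₁, 0 ≤ x' (Sum.inl i)) →
      ∑ j, (x j - v j)^2 ≤ ∑ j, (x' j - v j)^2) :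
    ∃ (y : Fin m → ℝ) (z : Fin n₁ → ℝ), (∀ i, 0 ≤ z i) ∧ (∀ i, z i * x (Sum.inl i) = 0) ∧
      ∀ j, x j - v j = Sum.elim z (fun _ => (0:ℝ)) j + Aᵀ.mulVec y j := by
  classical
  let row (k : Fin m) : (Fin n₁ ⊕ Fin n₂ → ℝ) →ₗ[ℝ] ℝ := LinearMap.proj k ∘ₗ A.mulVecLin
  obtain ⟨l, hl, hsum⟩ := exists_nonneg_sum_smul_of_nonneg
    ((Finset.univ : Finset (Fin m ⊕ Fin m)).disjSum
      (Finset.univ.filter fun i : Fin n₁ => x (Sum.inl i) = 0))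
    (Sum.elim (Sum.elim row (fun k => -row k)) (fun i => LinearMap.proj (Sum.inl i)))
    (∑ j, (x j - v j) • LinearMap.proj j) (by
      intro d hd
      have hA : A.mulVec d = 0 := by
        ext k
        have h1 := hd (Sum.inl (Sum.inl k)) (by simp)
        have h2 := hd (Sum.inl (Sum.inr k)) (by simp)
        simp only [Sum.elim_inl, Sum.elim_inr, LinearMap.neg_apply, row, LinearMap.comp_apply,
          LinearMap.proj_apply, Matrix.mulVecLin_apply] at h1 h2
        simp only [Pi.zero_apply]
        linarith
      have hact : ∀ i : Fin n₁, x (Sum.inl i) = 0 → 0 ≤ d (Sum.inl i) := fun i hi => by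
        simpa using hd (Sum.inr i) (by simp [hi])
      have hev : ∀ᶠ t : ℝ in nhdsWithin 0 (Set.Ioi 0),
          ∀ i : Fin n₁, 0 ≤ x (Sum.inl i) + t * d (Sum.inl i) := by
        refine Filter.eventually_all.mpr fun i => ?_
        rcases (hx₀ i).eq_or_lt with hi | hi
        · filter_upwards [self_mem_nhdsWithin] with t ht
          rw [← hi, zero_add]
          exact mul_nonneg (le_of_lt ht) (hact i hi.symm)
        · have hcont : Continuous fun t : ℝ => x (Sum.inl i) + t * d (Sum.inl i) := by fun_prop
          filter_upwards [nhdsWithin_le_nhds ((hcont.tendsto 0).eventually_const_lt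
            (by simpa using hi))] with t ht using le_of_lt ht
      have := sum_mul_nonneg_of_eventually_sum_sq_le (fun j => x j - v j) d (by
        filter_upwards [hev] with t ht
        have := hmin (x + t • d) (by rw [Matrix.mulVec_add, Matrix.mulVec_smul, hA, hx]; simp) ht
        refine this.trans_eq (Finset.sum_congr rfl fun j _ => ?_)
        simp only [Pi.add_apply, Pi.smul_apply, smul_eq_mul]
        ring)
      simpa [LinearMap.sum_apply] using this)
  refine ⟨fun k => l (Sum.inl (Sum.inl k)) - l (Sum.inl (Sum.inr k)),
    fun i => if x (Sum.inl i) = 0 then l (Sum.inr i) else 0, fun i => ?_, fun i => ?_, fun j => ?_⟩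
  · dsimp only
    split_ifs
    exacts [hl _, le_rfl]
  · by_cases hi : x (Sum.inl i) = 0 <;> simp [hi]
  · have hleft : (∑ k, (x k - v k) • LinearMap.proj k : (Fin n₁ ⊕ Fin n₂ → ℝ) →ₗ[ℝ] ℝ)
        (Pi.single j 1) = x j - v j := by
      rcases j with i | i <;> simp [LinearMap.sum_apply, Pi.single_apply]
    have hj := hleft.symm.trans (LinearMap.congr_fun hsum (Pi.single j 1))
    rw [Finset.sum_disjSum, Fintype.sum_sum_type] at hj
    simp only [LinearMap.sum_apply, LinearMap.add_apply, LinearMap.smul_apply,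
      LinearMap.neg_apply, LinearMap.proj_apply, Sum.elim_inl, Sum.elim_inr, row,
      LinearMap.comp_apply, Matrix.mulVecLin_apply, Matrix.mulVec_single_one, Matrix.col_apply,
      smul_eq_mul] at hj
    rw [Finset.sum_filter] at hj
    have hA : Aᵀ.mulVec (fun k => l (Sum.inl (Sum.inl k)) - l (Sum.inl (Sum.inr k))) j
        = ∑ k, l (Sum.inl (Sum.inl k)) * A k j + ∑ k, l (Sum.inl (Sum.inr k)) * -A k j := by
      simp only [Matrix.mulVec, dotProduct, Matrix.transpose_apply, ← Finset.sum_add_distrib]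
      exact Finset.sum_congr rfl fun k _ => by ring
    rw [hA]
    rw [hj, add_comm]
    congr 1
    rcases j with i | i
    · rw [Finset.sum_eq_single i (fun k _ hk => by simp [hk]) (by simp)]
      split_ifs with hi <;> simp [hi]
    · simp

/-- Strong duality for the best approximation problem with free variables:
    min over Q = {x : Ax = b, x₁ ≥ 0} of (1/2)‖x − v‖² equals the attained maximum
    over y ∈ ℝ^m, z₁ ≥ 0 of φ_f(y,z₁) = −(1/2)‖(z₁,0)+Aᵀy‖² + yᵀ(b−Av) − z₁ᵀv₁. -/
theorem stmt16 {m n₁ n₂ : ℕ} (A : Matrix (Fin m) (Fin n₁ ⊕ Fin n₂) ℝ)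
    (b : Fin m → ℝ) (v : Fin n₁ ⊕ Fin n₂ → ℝ)
    (hQ : ∃ x : Fin n₁ ⊕ Fin n₂ → ℝ, A.mulVec x = b ∧ ∀ i : Fin n₁, 0 ≤ x (Sum.inl i)) :
    ∃ p : ℝ,
      (∃ xstar : Fin n₁ ⊕ Fin n₂ → ℝ,
        (A.mulVec xstar = b ∧ ∀ i : Fin n₁, 0 ≤ xstar (Sum.inl i)) ∧
        (1/2) * ∑ j, (xstar j - v j)^2 = p ∧
        ∀ x : Fin n₁ ⊕ Fin n₂ → ℝ, A.mulVec x = b → (∀ i : Fin n₁, 0 ≤ x (Sum.inl i)) →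
          p ≤ (1/2) * ∑ j, (x j - v j)^2) ∧
      (∃ (y : Fin m → ℝ) (z₁ : Fin n₁ → ℝ), (∀ i, 0 ≤ z₁ i) ∧
        (-(1/2) * ∑ j, (Sum.elim z₁ (fun _ => (0:ℝ)) j + Aᵀ.mulVec y j)^2
          + y ⬝ᵥ (b - A.mulVec v) - ∑ i, z₁ i * v (Sum.inl i) = p) ∧
        ∀ (y' : Fin m → ℝ) (z₁' : Fin n₁ → ℝ), (∀ i, 0 ≤ z₁' i) →
          -(1/2) * ∑ j, (Sum.elim z₁' (fun _ => (0:ℝ)) j + Aᵀ.mulVec y' j)^2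
            + y' ⬝ᵥ (b - A.mulVec v) - ∑ i, z₁' i * v (Sum.inl i) ≤ p) := by
  have hclosed : IsClosed {x : Fin n₁ ⊕ Fin n₂ → ℝ |
      A.mulVec x = b ∧ ∀ i : Fin n₁, 0 ≤ x (Sum.inl i)} := by
    simp only [Set.ofPred_and, Set.ofPred_forall]
    exact (isClosed_eq (by fun_prop) continuous_const).inter
      (isClosed_iInter fun i => isClosed_le continuous_const (continuous_apply _))
  obtain ⟨x, ⟨hx, hx₀⟩, hmin⟩ := hclosed.exists_forall_sum_sq_le hQ v
  obtain ⟨y, z, hz, hzx, hw⟩ := exists_multipliers_of_forall_sum_sq_le A b v x hx hx₀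
    fun x' h h₀ => hmin x' ⟨h, h₀⟩
  refine ⟨(1/2) * ∑ j, (x j - v j)^2, ⟨x, ⟨hx, hx₀⟩, rfl, fun x' h h₀ => ?_⟩,
    y, z, hz, ?_, fun y' z' hz' => ?_⟩
  · linarith [hmin x' ⟨h, h₀⟩]
  · have hgap := primal_sub_dual_eq A b v x hx y z
    have hsq : ∑ j, (x j - v j - (Sum.elim z (fun _ => (0:ℝ)) j + Aᵀ.mulVec y j))^2 = 0 :=
      Finset.sum_eq_zero fun j _ => by rw [hw j, sub_self, sq, zero_mul]
    rw [hsq, Finset.sum_eq_zero fun i _ => hzx i] at hgap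
    linarith
  · have hgap := primal_sub_dual_eq A b v x hx y' z'
    have hsq : 0 ≤ ∑ j, (x j - v j - (Sum.elim z' (fun _ => (0:ℝ)) j + Aᵀ.mulVec y' j))^2 :=
      Finset.sum_nonneg fun _ _ => sq_nonneg _
    have hzx' : 0 ≤ ∑ i, z' i * x (Sum.inl i) :=
      Finset.sum_nonneg fun i _ => mul_nonneg (hz' i) (hx₀ i)
    linarith
end
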